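/- Let ζ, t, d, k be positive integers with d > k, let G = (Z_ζ)^t, and for μ = 1, ..., z (with z ≤ t and d-k+z ≤ ζ, and (d-k+μ) dividing ζ for each μ) define G_μ = { g ∈ G : g(w_μ) ≡ 0 (mod d-k+μ) } for distinct coordinates w_1, ..., w_z ∈ [t]. Then |∪_{μ=1}^{z} G_μ| = z·ζ^t/(d-k+z). -/

import Mathlib

theorem ZMod.card_filter_val_mod_eq_zero {n m : ℕ} [NeZero n] (h : m ∣ n) :
    (Finset.univ.filter fun x : ZMod n => x.val % m = 0).card * m = n := by
  obtain ⟨q, hq⟩ := h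
  have hn : 0 < n := Nat.pos_of_ne_zero (NeZero.ne n)
  have hm : 0 < m := Nat.pos_of_ne_zero (by rintro rfl; simp at hq; omega)
  have hlt : ∀ x < q, m * x < n := fun x hx => hq ▸ Nat.mul_lt_mul_of_pos_left hx hm
  have hcard : (Finset.range q).card =
      (Finset.univ.filter fun x : ZMod n => x.val % m = 0).card := by
    refine Finset.card_nbij' (fun x => ((m * x : ℕ) : ZMod n)) (fun x => x.val / m) ?_ ?_ ?_ ?_
    · intro x hx
      have hx := hlt x (by simpa using hx)
      simp only [Finset.coe_filter, Finset.mem_univ, true_and, Set.mem_ofPred_eq]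
      rw [ZMod.val_cast_of_lt hx, Nat.mul_mod_right]
    · intro x _
      have hx := ZMod.val_lt x
      simp only [Finset.coe_range, Set.mem_Iio]
      exact Nat.div_lt_of_lt_mul (hq ▸ hx)
    · intro x hx
      have hx := hlt x (by simpa using hx)
      simp only [ZMod.val_cast_of_lt hx, Nat.mul_div_cancel_left x hm]
    · intro x hx
      have hx : x.val % m = 0 := by simpa using hx
      simp only [Nat.mul_div_cancel' (Nat.dvd_of_mod_eq_zero hx), ZMod.natCast_zmod_val]
  rw [← hcard, Finset.card_range, hq, mul_comm]

theorem ZMod.card_filter_val_mod_ne_zero {n a : ℕ} [NeZero n] (h : a + 1 ∣ n) :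
    ((Finset.univ.filter fun x : ZMod n => x.val % (a + 1) ≠ 0).card : ℚ) =
      n * (a / (a + 1)) := by
  have h₁ := ZMod.card_filter_val_mod_eq_zero h
  have h₂ := Finset.card_filter_add_card_filter_not (s := (Finset.univ : Finset (ZMod n)))
    (fun x => x.val % (a + 1) = 0)
  rw [Finset.card_univ, ZMod.card] at h₂
  have h₁' := congrArg (Nat.cast : ℕ → ℚ) h₁
  have h₂' := congrArg (Nat.cast : ℕ → ℚ) h₂
  push_cast at h₁' h₂'
  have ha : (a : ℚ) + 1 ≠ 0 := by positivity
  field_simp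
  linear_combination ((a : ℚ) + 1) * h₂' - h₁'

theorem Fin.prod_add_div_add_one {a : ℕ} (ha : 0 < a) (z : ℕ) :
    ∏ μ : Fin z, (((a + (μ : ℕ) : ℕ) : ℚ) / ((a + (μ : ℕ) : ℕ) + 1)) = a / (a + z) := by
  have ha' : (a : ℚ) ≠ 0 := by positivity
  induction z with
  | zero => simp [ha']
  | succ z ih =>
    have h₁ : (a : ℚ) + z ≠ 0 := by positivity
    have h₂ : (a : ℚ) + z + 1 ≠ 0 := by positivity
    rw [Fin.prod_univ_castSucc]
    simp only [Fin.val_castSucc, Fin.val_last]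
    rw [ih]
    push_cast
    rw [← add_assoc]
    field_simp

/-- The number of points of `(ZMod n)^ι` whose coordinate `w μ` avoids the multiples of
`a + μ + 1` for every `μ`. -/
theorem ZMod.card_filter_forall_val_mod_ne_zero {ι : Type*} [Fintype ι] [DecidableEq ι]
    {n a z : ℕ} [NeZero n] (ha : 0 < a) (hdvd : ∀ μ : Fin z, a + (μ : ℕ) + 1 ∣ n)
    {w : Fin z → ι} (hw : Function.Injective w) :
    ((Finset.univ.filter fun g : ι → ZMod n =>
      ∀ μ : Fin z, (g (w μ)).val % (a + (μ : ℕ) + 1) ≠ 0).card : ℚ) =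
      n ^ Fintype.card ι * (a / (a + z)) := by
  let S : ι → Finset (ZMod n) := fun i =>
    Finset.univ.filter fun x => ∀ μ : Fin z, w μ = i → x.val % (a + (μ : ℕ) + 1) ≠ 0
  have hS : (Finset.univ.filter fun g : ι → ZMod n =>
      ∀ μ : Fin z, (g (w μ)).val % (a + (μ : ℕ) + 1) ≠ 0) = Fintype.piFinset S := by
    ext g
    simp only [S, Finset.mem_filter, Finset.mem_univ, true_and, Fintype.mem_piFinset]
    exact ⟨fun h i μ hi => hi ▸ h μ, fun h μ => h _ μ rfl⟩
  have hn : (n : ℚ) ≠ 0 := by exact_mod_cast NeZero.ne n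
  have hprod : ∏ μ : Fin z, (((a + (μ : ℕ) : ℕ) : ℚ) / ((a + (μ : ℕ) : ℕ) + 1)) =
      ∏ i, ((S i).card : ℚ) / n := by
    refine Fintype.prod_of_injective w hw _ _ (fun i hi => ?_) (fun μ => ?_)
    · have : S i = Finset.univ :=
        Finset.filter_true_of_mem fun x _ μ hμ => (hi ⟨μ, hμ⟩).elim
      rw [this, Finset.card_univ, ZMod.card, div_self hn]
    · have : S (w μ) = Finset.univ.filter fun x : ZMod n => x.val % (a + (μ : ℕ) + 1) ≠ 0 := by
        refine Finset.filter_congr fun x _ => ⟨fun h => h μ rfl, fun h ν hν => ?_⟩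
        rwa [hw hν]
      rw [this, ZMod.card_filter_val_mod_ne_zero (hdvd μ), mul_div_cancel_left₀ _ hn]
  rw [hS, Fintype.card_piFinset, ← Fin.prod_add_div_add_one ha z, hprod, Finset.prod_div_distrib,
    Finset.prod_const, Finset.card_univ, Nat.cast_prod, mul_div_cancel₀ _ (pow_ne_zero _ hn)]


/-- Lemma 5: with `G = (Z_ζ)^t`, `G_μ = {g : g(w_μ) ≡ 0 mod (d-k+μ)}` for distinct
coordinates `w_1,…,w_z`, the union satisfies `|∪_μ G_μ| = z·ζ^t/(d-k+z)`. -/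
theorem stmt_12 (ζ t d k z : ℕ) [NeZero ζ] (ht : 0 < t) (hdk : k < d)
    (hz : z ≤ t) (hzζ : d - k + z ≤ ζ)
    (hdvd : ∀ μ : Fin z, (d - k + (μ : ℕ) + 1) ∣ ζ)
    (w : Fin z → Fin t) (hw : Function.Injective w)
    (Gμ : Fin z → Finset (Fin t → ZMod ζ))
    (hGμ : ∀ μ : Fin z, Gμ μ = Finset.univ.filter
      (fun g : Fin t → ZMod ζ => (g (w μ)).val % (d - k + (μ : ℕ) + 1) = 0)) :
    (Finset.univ.biUnion Gμ).card * (d - k + z) = z * ζ ^ t := by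
  have ha : 0 < d - k := Nat.sub_pos_of_lt hdk
  generalize d - k = a at *
  have hunion : Finset.univ.biUnion Gμ = Finset.univ.filter fun g : Fin t → ZMod ζ =>
      ¬ ∀ μ : Fin z, (g (w μ)).val % (a + (μ : ℕ) + 1) ≠ 0 := by
    ext g
    simp [hGμ]
  have hcompl := ZMod.card_filter_forall_val_mod_ne_zero ha hdvd hw
  have hadd := congrArg (Nat.cast : ℕ → ℚ) (Finset.card_filter_add_card_filter_not
    (s := (Finset.univ : Finset (Fin t → ZMod ζ)))
    (fun g => ∀ μ : Fin z, (g (w μ)).val % (a + (μ : ℕ) + 1) ≠ 0))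
  rw [← hunion, Nat.cast_add, hcompl, Finset.card_univ, Fintype.card_pi_const, ZMod.card,
    Fintype.card_fin, Nat.cast_pow] at hadd
  have haz : (a : ℚ) + z ≠ 0 := by positivity
  field_simp at hadd
  have : ((Finset.univ.biUnion Gμ).card : ℚ) * (a + z) = z * ζ ^ t := by
    linear_combination hadd
  exact_mod_cast this
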